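/- Let G=(V,E) be a finite graph on vertices {1,...,r}. For complex numbers s_1,...,s_r with Re(s_j) > 1 for all j, the multiple Dirichlet series D_G(s) = Σ over n_1,...,n_r ≥ 1 with gcd(n_k, n_l)=1 for all edges (k,l)∈E of n_1^{-s_1}···n_r^{-s_r} satisfies ζ(s_1)^{-1}···ζ(s_r)^{-1} D_G(s) = Π_p Σ_{U⊆E} (-1)^{|U|} Π_{j ∈ ver(U)} p^{-s_j}, where ver(U) is the set of vertices adjacent to at least one edge in U. -/

import Mathlib

open scoped BigOperators

/-- The vertex set of a subset `U` of edges: all vertices adjacent to some edge of `U`. -/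
def verSet {r : ℕ} (U : Finset (Fin r × Fin r)) : Finset (Fin r) :=
  U.biUnion (fun e => {e.1, e.2})

namespace MultipleEulerProduct

open Filter Topology Nat EulerProduct

/-- A product of absolutely summable families, indexed by tuples, is absolutely summable, and its
sum is the product of the sums. -/
lemma summable_and_hasSum_prod {R : Type*} [NormedCommRing R] [CompleteSpace R]
    {α : Type*} {r : ℕ} {f : Fin r → α → R} (hf : ∀ j, Summable (fun a ↦ ‖f j a‖)) :
    Summable (fun a : Fin r → α ↦ ‖∏ j, f j (a j)‖) ∧
      HasSum (fun a : Fin r → α ↦ ∏ j, f j (a j)) (∏ j, ∑' a, f j a) := by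
  induction r with
  | zero => simp [Summable.of_finite]
  | succ r ih =>
    obtain ⟨ih₁, ih₂⟩ := ih (f := fun j ↦ f j.succ) fun j ↦ hf j.succ
    constructor
    · rw [← (Fin.consEquiv fun _ ↦ α).summable_iff]
      refine Summable.of_nonneg_of_le (fun _ ↦ norm_nonneg _) (fun x ↦ ?_)
        ((hf 0).mul_of_nonneg ih₁ (fun _ ↦ norm_nonneg _) fun _ ↦ norm_nonneg _)
      simpa [Fin.prod_univ_succ, Fin.consEquiv] using norm_mul_le _ _
    · rw [← (Fin.consEquiv fun _ ↦ α).hasSum_iff, Fin.prod_univ_succ]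
      have : T3Space R := instT3Space
      simp only [Function.comp_def, Fin.prod_univ_succ, Fin.consEquiv, Equiv.coe_fn_mk,
        Fin.cons_zero, Fin.cons_succ]
      apply (hf 0).of_norm.hasSum.mul ih₂
      apply summable_mul_of_summable_norm (hf 0) ih₁

section General

variable {ι R : Type*} [NormedCommRing R] [CompleteSpace R] {F : (ι → ℕ) → R}

/-- Tuples of `insert p s`-factored numbers split into tuples of powers of `p` and tuples of
`s`-factored numbers. -/
noncomputable def piFactoredNumbersEquiv (ι : Type*) {s : Finset ℕ} {p : ℕ} (hp : p.Prime)
    (hs : p ∉ s) :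
    (ι → ℕ) × (ι → factoredNumbers s) ≃ (ι → factoredNumbers (insert p s)) :=
  (Equiv.arrowProdEquivProdArrow ι (fun _ ↦ ℕ) fun _ ↦ factoredNumbers s).symm.trans
    (Equiv.piCongrRight fun _ ↦ equivProdNatFactoredNumbers hp hs)

lemma piFactoredNumbersEquiv_apply {s : Finset ℕ} {p : ℕ} (hp : p.Prime) (hs : p ∉ s)
    (x : (ι → ℕ) × (ι → factoredNumbers s)) (j : ι) :
    (piFactoredNumbersEquiv ι hp hs x j : ℕ) = p ^ x.1 j * x.2 j := rfl

variable (hF₁ : F 1 = 1)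
  (hmul : ∀ {m n : ι → ℕ}, (∀ i j, Nat.Coprime (m i) (n j)) → F (m * n) = F m * F n)

include hF₁ hmul in
lemma summable_and_hasSum_pi_factoredNumbers (hsum : Summable (‖F ·‖)) (s : Finset ℕ) :
    Summable (fun m : ι → factoredNumbers s ↦ ‖F fun j ↦ m j‖) ∧
      HasSum (fun m : ι → factoredNumbers s ↦ F fun j ↦ m j)
        (∏ p ∈ s with p.Prime, ∑' a : ι → ℕ, F fun j ↦ p ^ a j) := by
  induction s using Finset.induction with
  | empty =>
    have key : ∀ m : ι → factoredNumbers ∅, (fun j ↦ (m j : ℕ)) = 1 := fun m ↦ by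
      ext j
      simpa [factoredNumbers_empty] using (m j).2
    have : Unique (ι → factoredNumbers ∅) :=
      { default := fun _ ↦ ⟨1, by simp [factoredNumbers_empty]⟩
        uniq := fun m ↦ by
          ext j
          exact congrFun (key m) j }
    refine ⟨Summable.of_finite, ?_⟩
    simp only [key, hF₁]
    simp
  | insert p s hp ih =>
    rw [Finset.filter_insert]
    split_ifs with hpp
    · have hsplit (x : (ι → ℕ) × (ι → factoredNumbers s)) :
          (F fun j ↦ piFactoredNumbersEquiv ι hpp hp x j) =
            (F fun j ↦ p ^ x.1 j) * F fun j ↦ x.2 j := by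
        simp only [piFactoredNumbersEquiv_apply]
        exact hmul fun i j ↦ Coprime.pow_left _ <| hpp.factoredNumbers_coprime hp (x.2 j).2
      have hpsum : Summable (fun a : ι → ℕ ↦ ‖F fun j ↦ p ^ a j‖) :=
        hsum.comp_injective (i := fun (a : ι → ℕ) j ↦ p ^ a j) fun a b h ↦
          funext fun j ↦ Nat.pow_right_injective hpp.two_le (congrFun h j)
      constructor
      · rw [← (piFactoredNumbersEquiv ι hpp hp).summable_iff]
        simp only [Function.comp_def, hsplit]
        exact Summable.of_nonneg_of_le (fun _ ↦ norm_nonneg _) (fun _ ↦ norm_mul_le ..)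
          (hpsum.mul_of_nonneg ih.1 (fun _ ↦ norm_nonneg _) fun _ ↦ norm_nonneg _)
      · rw [Finset.prod_insert (mt (Finset.mem_of_mem_filter p) hp),
          ← (piFactoredNumbersEquiv ι hpp hp).hasSum_iff]
        simp only [Function.comp_def, hsplit]
        have : T3Space R := instT3Space
        apply hpsum.of_norm.hasSum.mul ih.2
        apply summable_mul_of_summable_norm hpsum ih.1
    · rwa [factoredNumbers_insert s hpp]

include hF₁ hmul in
/-- The Euler product for functions on tuples of natural numbers that are multiplicative on
coprime arguments. -/
theorem hasProd_tsum_pi [Finite ι] (hsum : Summable (‖F ·‖)) (hF₀ : ∀ n : ι → ℕ, (∃ j, n j = 0) → F n = 0) :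
    HasProd (fun p : Primes ↦ ∑' a : ι → ℕ, F fun j ↦ (p : ℕ) ^ a j) (∑' n, F n) := by
  let G : ℕ → R := fun p ↦ ∑' a : ι → ℕ, F fun j ↦ p ^ a j
  change HasProd (G ∘ Subtype.val (p := (· ∈ {x | Nat.Prime x}))) _
  rw [hasProd_subtype_iff_mulIndicator, HasProd, SummationFilter.unconditional_filter]
  let A (s : Finset ℕ) : Set (ι → ℕ) := {n | ∀ j, n j ∈ factoredNumbers s}
  have hA (s : Finset ℕ) :
      ∏ p ∈ s, {p | Nat.Prime p}.mulIndicator G p = ∑' n, (A s).indicator F n := by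
    have hprod := Finset.prod_mulIndicator_eq_prod_filter s (fun _ ↦ G)
      (fun _ ↦ {p | Nat.Prime p}) id
    simp only [id] at hprod
    rw [hprod, ← tsum_subtype]
    refine (summable_and_hasSum_pi_factoredNumbers hF₁ hmul hsum s).2.tsum_eq.symm.trans ?_
    exact (Equiv.subtypePiEquivPi (p := fun (_ : ι) n ↦ n ∈ factoredNumbers s)).symm.tsum_eq
      fun n : A s ↦ F n
  simp only [hA]
  refine tendsto_tsum_of_dominated_convergence hsum (fun n ↦ ?_)
    (.of_forall fun s n ↦ norm_indicator_le_norm_self _ _)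
  by_cases hn : ∃ j, n j = 0
  · simp [Set.indicator_apply_eq_zero.mpr fun _ ↦ hF₀ n hn, hF₀ n hn]
  · push Not at hn
    have := Fintype.ofFinite ι
    refine tendsto_const_nhds.congr' ?_
    filter_upwards [eventually_ge_atTop (Finset.univ.biUnion fun j ↦ (n j).primeFactors)]
      with s hs
    rw [Set.indicator_of_mem]
    exact fun j ↦ mem_factoredNumbers_of_primeFactors_subset (hn j) fun p hp ↦
      hs <| Finset.mem_biUnion.mpr ⟨j, Finset.mem_univ j, hp⟩

end General

/-- The indicator function of a conjunction of negations, expanded by inclusion-exclusion. -/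
lemma ite_forall_not_eq_sum_powerset {α R : Type*} [CommRing R] (E : Finset α) (P : α → Prop)
    [DecidablePred P] [Decidable (∀ e ∈ E, ¬ P e)] :
    (if ∀ e ∈ E, ¬ P e then (1 : R) else 0) =
      ∑ U ∈ E.powerset, (-1) ^ U.card * if ∀ e ∈ U, P e then 1 else 0 := by
  have h (U : Finset α) : ((-1) ^ U.card * if ∀ e ∈ U, P e then 1 else 0 : R) =
      ∏ e ∈ U, -(if P e then 1 else 0) := by
    rw [Finset.prod_neg, Finset.prod_ite_zero, Finset.prod_const_one]
  simp only [h, ← Finset.prod_one_add]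
  trans ∏ e ∈ E, if ¬ P e then 1 else 0
  · rw [Finset.prod_ite_zero, Finset.prod_const_one]
    congr
  refine Finset.prod_congr rfl fun e _ ↦ ?_
  by_cases hP : P e <;> simp [hP]

lemma forall_mem_verSet {r : ℕ} {U : Finset (Fin r × Fin r)} {P : Fin r → Prop} :
    (∀ j ∈ verSet U, P j) ↔ ∀ e ∈ U, P e.1 ∧ P e.2 := by
  simp only [verSet, Finset.mem_biUnion, Finset.mem_insert, Finset.mem_singleton]
  grind

/-- The geometric series over tuples of exponents whose support contains no edge of `E`. -/
lemma prod_one_sub_mul_tsum_geometric {r : ℕ} (E : Finset (Fin r × Fin r)) {x : Fin r → ℂ}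
    (hx : ∀ j, ‖x j‖ < 1) :
    (∏ j, (1 - x j)) * ∑' a : Fin r → ℕ,
        (if ∀ e ∈ E, ¬ (a e.1 ≠ 0 ∧ a e.2 ≠ 0) then ∏ j, x j ^ a j else 0) =
      ∑ U ∈ E.powerset, (-1 : ℂ) ^ U.card * ∏ j ∈ verSet U, x j := by
  have hx1 (j) : 1 - x j ≠ 0 := sub_ne_zero.mpr fun h ↦ by simpa [← h] using hx j
  let f (U : Finset (Fin r × Fin r)) (j : Fin r) (n : ℕ) : ℂ :=
    if j ∈ verSet U → n ≠ 0 then x j ^ n else 0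
  have hfsum (U j) : Summable (fun n ↦ ‖f U j n‖) := by
    refine Summable.of_nonneg_of_le (fun _ ↦ norm_nonneg _) (fun n ↦ ?_)
      (summable_geometric_of_lt_one (norm_nonneg _) (hx j))
    simp only [f]
    split_ifs <;> simp
  have hft (U j) : ∑' n, f U j n = (1 - x j)⁻¹ * if j ∈ verSet U then x j else 1 := by
    by_cases h : j ∈ verSet U
    · rw [(hfsum U j).of_norm.tsum_eq_zero_add]
      simp [f, h, pow_succ, tsum_mul_right, tsum_geometric_of_norm_lt_one (hx j)]
    · simp [f, h, tsum_geometric_of_norm_lt_one (hx j)]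
  have hfprod (U) : ∏ j, ∑' n, f U j n = (∏ j, (1 - x j))⁻¹ * ∏ j ∈ verSet U, x j := by
    simp only [hft, Finset.prod_mul_distrib, Finset.prod_inv_distrib, Finset.prod_ite_mem,
      Finset.univ_inter]
  have hsum : HasSum (fun a : Fin r → ℕ ↦
        if ∀ e ∈ E, ¬ (a e.1 ≠ 0 ∧ a e.2 ≠ 0) then ∏ j, x j ^ a j else 0)
      (∑ U ∈ E.powerset, (-1 : ℂ) ^ U.card * ∏ j, ∑' n, f U j n) := by
    have hexpand (a : Fin r → ℕ) :
        (if ∀ e ∈ E, ¬ (a e.1 ≠ 0 ∧ a e.2 ≠ 0) then ∏ j, x j ^ a j else 0) =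
          ∑ U ∈ E.powerset, (-1 : ℂ) ^ U.card * ∏ j, f U j (a j) := by
      rw [← one_mul (∏ j, x j ^ a j), ← ite_zero_mul,
        ite_forall_not_eq_sum_powerset E (fun e ↦ a e.1 ≠ 0 ∧ a e.2 ≠ 0), Finset.sum_mul]
      refine Finset.sum_congr rfl fun U _ ↦ ?_
      simp only [f, Finset.prod_ite_zero, mul_assoc, ite_mul, one_mul, zero_mul,
        ← forall_mem_verSet (P := fun j ↦ a j ≠ 0), Finset.mem_univ, forall_const]
    simp only [hexpand]
    exact hasSum_sum fun U _ ↦ (summable_and_hasSum_prod (hfsum U)).2.mul_left ((-1) ^ U.card)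
  rw [hsum.tsum_eq, Finset.mul_sum]
  refine Finset.sum_congr rfl fun U _ ↦ ?_
  rw [hfprod, mul_left_comm, mul_inv_cancel_left₀ (Finset.prod_ne_zero_iff.mpr fun j _ ↦ hx1 j)]

/-- The summand of the multiple Dirichlet series attached to the edge set `E`. -/
noncomputable def summand {r : ℕ} (E : Finset (Fin r × Fin r)) (s : Fin r → ℂ) (n : Fin r → ℕ) :
    ℂ :=
  if ∀ e ∈ E, Nat.Coprime (n e.1) (n e.2) then ∏ j, (n j : ℂ) ^ (-(s j)) else 0

section Summand

variable {r : ℕ} (E : Finset (Fin r × Fin r)) {s : Fin r → ℂ}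

lemma summand_one : summand E s 1 = 1 := by simp [summand]

lemma summand_mul {m n : Fin r → ℕ} (h : ∀ i j, Nat.Coprime (m i) (n j)) :
    summand E s (m * n) = summand E s m * summand E s n := by
  have h₁ (i j) : Nat.Coprime (m i) (n j) ↔ True := iff_true_intro (h i j)
  have h₂ (i j) : Nat.Coprime (n i) (m j) ↔ True := iff_true_intro (h j i).symm
  simp only [summand, Pi.mul_apply, Nat.cast_mul, Complex.natCast_mul_natCast_cpow,
    Finset.prod_mul_distrib, Nat.coprime_mul_iff_left, Nat.coprime_mul_iff_right, h₁, h₂,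
    and_true, true_and, ite_zero_mul_ite_zero, forall_and]

lemma summand_eq_zero (hs : ∀ j, 1 < (s j).re) {n : Fin r → ℕ} (hn : ∃ j, n j = 0) :
    summand E s n = 0 := by
  obtain ⟨j, hj⟩ := hn
  refine ite_eq_right_iff.mpr fun _ ↦ Finset.prod_eq_zero (Finset.mem_univ j) ?_
  simp [hj, Complex.ne_zero_of_one_lt_re (hs j)]

lemma summable_norm_summand (hs : ∀ j, 1 < (s j).re) : Summable (‖summand E s ·‖) := by
  refine Summable.of_nonneg_of_le (fun _ ↦ norm_nonneg _) (fun n ↦ ?_)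
    (summable_and_hasSum_prod (f := fun j (n : ℕ) ↦ (n : ℂ) ^ (-(s j)))
      fun j ↦ summable_riemannZetaSummand (hs j)).1
  unfold summand
  split_ifs
  · rfl
  · simpa using Finset.prod_nonneg fun _ _ ↦ norm_nonneg _

lemma summand_prime_pow {p : ℕ} (hp : p.Prime) (a : Fin r → ℕ) :
    (summand E s fun j ↦ p ^ a j) =
      if ∀ e ∈ E, ¬ (a e.1 ≠ 0 ∧ a e.2 ≠ 0) then ∏ j, ((p : ℂ) ^ (-(s j))) ^ a j else 0 := by
  have h (k l : ℕ) : Nat.Coprime (p ^ k) (p ^ l) ↔ ¬ (k ≠ 0 ∧ l ≠ 0) := by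
    rcases k.eq_zero_or_pos with rfl | hk
    · simp
    rcases l.eq_zero_or_pos with rfl | hl
    · simp
    simp [Nat.coprime_pow_left_iff hk, Nat.coprime_pow_right_iff hl, hp.ne_one, hk.ne', hl.ne']
  have hpow (j) : ((p ^ a j : ℕ) : ℂ) ^ (-(s j)) = ((p : ℂ) ^ (-(s j))) ^ a j := by
    rw [Nat.cast_pow, ← Complex.natCast_cpow_natCast_mul, Complex.cpow_nat_mul]
  simp only [summand, h, hpow]

lemma tsum_pnat_eq_tsum_summand (hs : ∀ j, 1 < (s j).re) :
    (∑' n : Fin r → ℕ+, if ∀ e ∈ E, Nat.Coprime (n e.1 : ℕ) (n e.2 : ℕ)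
      then ∏ j, ((n j : ℕ) : ℂ) ^ (-(s j)) else 0) = ∑' n, summand E s n := by
  refine Function.Injective.tsum_eq (f := summand E s)
    (g := fun (n : Fin r → ℕ+) j ↦ (n j : ℕ)) (fun m n h ↦ ?_) fun n hn ↦ ?_
  · exact funext fun j ↦ PNat.coe_injective (congrFun h j)
  · have hn0 (j) : 0 < n j := Nat.pos_of_ne_zero fun h ↦ hn (summand_eq_zero E hs ⟨j, h⟩)
    exact ⟨fun j ↦ ⟨n j, hn0 j⟩, rfl⟩

end Summand

end MultipleEulerProduct

/-- Theorem 3: for a graph `G = ({1,…,r}, E)` and `Re s_j > 1`,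
`ζ(s_1)⁻¹ ⋯ ζ(s_r)⁻¹ D_G(s) = ∏_p ∑_{U ⊆ E} (-1)^{|U|} ∏_{j ∈ ver U} p^{-s_j}`. -/
theorem multiple_dirichlet_series_euler_product
    (r : ℕ) (E : Finset (Fin r × Fin r)) (s : Fin r → ℂ)
    (hs : ∀ j, 1 < (s j).re) :
    (∏ j, (riemannZeta (s j))⁻¹) *
      (∑' n : Fin r → ℕ+,
        if ∀ e ∈ E, Nat.Coprime (n e.1 : ℕ) (n e.2 : ℕ)
        then ∏ j, ((n j : ℕ) : ℂ) ^ (-(s j)) else 0)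
    = ∏' p : Nat.Primes,
        ∑ U ∈ E.powerset, (-1 : ℂ) ^ U.card * ∏ j ∈ verSet U, ((p : ℕ) : ℂ) ^ (-(s j)) := by
  open MultipleEulerProduct in
  have hζ := hasProd_prod (s := Finset.univ) fun j _ ↦
    (riemannZeta_eulerProduct_hasProd (hs j)).inv₀ (riemannZeta_ne_zero_of_one_lt_re (hs j))
  have hD := hasProd_tsum_pi (summand_one E) (summand_mul E) (summable_norm_summand E hs)
    fun _ ↦ summand_eq_zero E hs
  rw [tsum_pnat_eq_tsum_summand E hs, ← (hζ.mul hD).tprod_eq]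
  refine tprod_congr fun p ↦ ?_
  have hx (j) : ‖((p : ℕ) : ℂ) ^ (-(s j))‖ < 1 := by
    rw [Complex.norm_natCast_cpow_of_pos p.2.pos]
    exact Real.rpow_lt_one_of_one_lt_of_neg (mod_cast p.2.one_lt)
      (by simpa using one_pos.trans (hs j))
  simp only [inv_inv, summand_prime_pow E p.2]
  exact prod_one_sub_mul_tsum_geometric E hx
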